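/- Let n and f be natural numbers with f < n, and let t = n - ⌊(n - f - 1)/2⌋ - 1 (floor division). Let S be a finite set with |S| = n and let C ⊆ S with |C| = f. Then there exist disjoint sets H₁, H₂ ⊆ S \ C with H₁ ∪ H₂ = S \ C such that |C ∪ H₁| ≥ t and |C ∪ H₂| ≥ t. -/

import Mathlib

/-- Given a set `S` of `n` operators with corrupted subset `C` of size `f < n`,
and execution threshold `t = n - ⌊(n - f - 1)/2⌋ - 1`, the honest operators
`S \ C` can be split into two disjoint halves `H₁`, `H₂` such that the
corrupted coalition together with each half separately meets the threshold. -/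
theorem honest_split_attack {α : Type*} [DecidableEq α]
    (n f : ℕ) (hfn : f < n) (t : ℕ) (ht : t = n - (n - f - 1) / 2 - 1)
    (S : Finset α) (hS : S.card = n) (C : Finset α) (hCS : C ⊆ S)
    (hC : C.card = f) :
    ∃ H₁ H₂ : Finset α, H₁ ⊆ S \ C ∧ H₂ ⊆ S \ C ∧ Disjoint H₁ H₂ ∧
      H₁ ∪ H₂ = S \ C ∧ t ≤ (C ∪ H₁).card ∧ t ≤ (C ∪ H₂).card := by
  have hm : (S \ C).card = n - f := by rw [Finset.card_sdiff_of_subset hCS, hS, hC]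
  obtain ⟨H, hH, hcard⟩ := Finset.exists_subset_card_eq (s := S \ C) (n := (n - f) / 2) (by omega)
  have hcompl : ((S \ C) \ H).card = (n - f) - (n - f) / 2 := by
    rw [Finset.card_sdiff_of_subset hH, hm, hcard]
  have hunion : ∀ K ⊆ S \ C, (C ∪ K).card = f + K.card := fun K hK => by
    rw [Finset.card_union_of_disjoint (Finset.disjoint_sdiff.mono_right hK), hC]
  refine ⟨H, (S \ C) \ H, hH, Finset.sdiff_subset, Finset.disjoint_sdiff,
    Finset.union_sdiff_of_subset hH, ?_, ?_⟩
  · rw [hunion H hH]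
    omega
  · rw [hunion _ Finset.sdiff_subset]
    omega
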